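/- Let 0 < p < 1, w > 0, set τ = τ_p(w) and δ₀ = (2w(1−p))^{1/(2−p)}. Then δ₀ satisfies simultaneously the stationary equation δ₀ − τ + w·p·δ₀^{p−1} = 0 and the tie condition f_{τ,w,p}(δ₀) = f_{τ,w,p}(0), i.e., ½(δ₀−τ)² + w·δ₀^p = ½τ². In particular, at σ = τ_p(w) both 0 and δ₀ are global minimizers of f_{σ,w,p} on [0,∞). -/

import Mathlib

/-- The scalar GST objective `f_{σ,w,p}(δ) = ½(δ−σ)² + w·δ^p` (real power). -/
noncomputable def fobj (σ w p δ : ℝ) : ℝ := (1 / 2) * (δ - σ) ^ 2 + w * δ ^ p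

/-- The GST threshold `τ_p(w) = (2w(1−p))^{1/(2−p)} + w·p·(2w(1−p))^{(p−1)/(2−p)}`. -/
noncomputable def gstThreshold (p w : ℝ) : ℝ :=
  (2 * w * (1 - p)) ^ (1 / (2 - p)) + w * p * (2 * w * (1 - p)) ^ ((p - 1) / (2 - p))

/-- **Bernoulli's inequality** for nonpositive real exponents. -/
theorem one_add_mul_sub_one_le_rpow_of_nonpos {r t : ℝ} (hr : r ≤ 0) (ht : 0 < t) :
    1 + r * (t - 1) ≤ t ^ r := by
  have hr1 : 0 < 1 - r := by linarith
  have h := Real.geom_mean_le_arith_mean2_weighted (w₁ := -r / (1 - r)) (w₂ := 1 / (1 - r))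
    (p₁ := t) (p₂ := t ^ r) (div_nonneg (by linarith) hr1.le)
    (div_nonneg zero_le_one hr1.le) ht.le (Real.rpow_nonneg ht.le _)
    (by field_simp; ring)
  rw [← Real.rpow_mul ht.le, ← Real.rpow_add ht,
    show -r / (1 - r) + r * (1 / (1 - r)) = 0 by ring, Real.rpow_zero,
    show -r / (1 - r) * t + 1 / (1 - r) * t ^ r = (-r * t + t ^ r) / (1 - r) by ring,
    le_div_iff₀ hr1] at h
  linarith

/-- At `σ = τ_p(w)`, the point `δ₀ = (2w(1−p))^{1/(2−p)}` satisfies the stationary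
equation `δ₀ − τ + w·p·δ₀^{p−1} = 0` and the tie condition
`½(δ₀−τ)² + w·δ₀^p = ½τ²`; in particular both `0` and `δ₀` are global minimizers
of `f_{τ,w,p}` on `[0,∞)`. -/
theorem gstThreshold_tie (p w : ℝ) (hp : 0 < p) (hp1 : p < 1) (hw : 0 < w) :
    let τ := gstThreshold p w
    let δ₀ := (2 * w * (1 - p)) ^ (1 / (2 - p))
    (δ₀ - τ + w * p * δ₀ ^ (p - 1) = 0) ∧
      ((1 / 2) * (δ₀ - τ) ^ 2 + w * δ₀ ^ p = (1 / 2) * τ ^ 2) ∧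
      (∀ δ : ℝ, 0 ≤ δ → fobj τ w p 0 ≤ fobj τ w p δ) ∧
      (∀ δ : ℝ, 0 ≤ δ → fobj τ w p δ₀ ≤ fobj τ w p δ) := by
  intro τ δ₀
  have hbase : 0 < 2 * w * (1 - p) := mul_pos (by linarith) (by linarith)
  have hδ₀ : 0 < δ₀ := Real.rpow_pos_of_pos hbase _
  have hτ : τ = δ₀ + w * p * δ₀ ^ (p - 1) := by
    simp only [τ, δ₀, gstThreshold]
    rw [← Real.rpow_mul hbase.le, one_div_mul_eq_div]
  have hpow : δ₀ ^ p = δ₀ ^ (p - 1) * δ₀ := by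
    rw [← Real.rpow_add_one hδ₀.ne', sub_add_cancel]
  -- the defining relation of `δ₀`, in terms of `δ₀ ^ (p - 1)`
  have hrel : 2 * w * (1 - p) * δ₀ ^ (p - 1) = δ₀ := by
    have h : δ₀ ^ (2 - p) = 2 * w * (1 - p) := by
      rw [← Real.rpow_mul hbase.le, one_div_mul_cancel (by linarith), Real.rpow_one]
    rw [← h, ← Real.rpow_add hδ₀, show 2 - p + (p - 1) = 1 by ring, Real.rpow_one]
  have htie : (1 / 2) * (δ₀ - τ) ^ 2 + w * δ₀ ^ p = (1 / 2) * τ ^ 2 := by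
    rw [hτ, hpow]
    linear_combination (1 / 2) * δ₀ * hrel
  have hzero : fobj τ w p 0 = (1 / 2) * τ ^ 2 := by
    simp [fobj, Real.zero_rpow hp.ne']
  have hmin : ∀ δ : ℝ, 0 ≤ δ → (1 / 2) * τ ^ 2 ≤ fobj τ w p δ := by
    intro δ hδ
    rcases hδ.eq_or_lt with rfl | hδ
    · exact hzero.ge
    obtain ⟨t, ht, rfl⟩ : ∃ t, 0 < t ∧ δ = δ₀ * t :=
      ⟨δ / δ₀, div_pos hδ hδ₀, (mul_div_cancel₀ δ hδ₀.ne').symm⟩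
    have hB := mul_le_mul_of_nonneg_left
      (one_add_mul_sub_one_le_rpow_of_nonpos (show p - 1 ≤ 0 by linarith) ht)
      (show 0 ≤ w * δ₀ ^ (p - 1) * (δ₀ * t) by positivity)
    have hpt : t ^ p = t ^ (p - 1) * t := by
      rw [← Real.rpow_add_one ht.ne', sub_add_cancel]
    rw [fobj, Real.mul_rpow hδ₀.le ht.le, hpow, hpt, hτ]
    linear_combination hB + (1 / 2) * δ₀ * t * (t - 2) * hrel
  refine ⟨by rw [hτ]; ring, htie, fun δ hδ => hzero.trans_le (hmin δ hδ), fun δ hδ => ?_⟩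
  exact htie.trans_le (hmin δ hδ)
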